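/- arXiv:1412.7918 — 5 statements merged into one kernel-verified Lean document; each statement's English description precedes it below -/
import Mathlib

section
/- Let g ∈ Sp(1,1). Then the trace of g·ι(A)·g⁻¹ is real for every A ∈ SU(1,1) if and only if there exist a quaternion h with ‖h‖ = 1 and a matrix A₀ ∈ SU(1,1) such that g = h·ι(A₀), where h·ι(A₀) denotes the entrywise left scalar multiple of ι(A₀) by h. -/
open Matrix BigOperators

noncomputable section

abbrev Hq : Type := Quaternion ℝ

def qi : Hq := ⟨0, 1, 0, 0⟩
def qj : Hq := ⟨0, 0, 1, 0⟩
def qk : Hq := ⟨0, 0, 0, 1⟩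

/-- A quaternion is real if all its imaginary parts vanish. -/
def isRealQ (q : Hq) : Prop := q.imI = 0 ∧ q.imJ = 0 ∧ q.imK = 0

/-- The matrix `J_{n,1}` with diagonal `(1,…,1,−1)`. -/
def Jq (n : ℕ) : Matrix (Fin (n+1)) (Fin (n+1)) Hq :=
  Matrix.diagonal fun i => if i = Fin.last n then -1 else 1

/-- `Sp(n,1)` as a set of `(n+1)×(n+1)` quaternionic matrices. -/
def Sp (n : ℕ) : Set (Matrix (Fin (n+1)) (Fin (n+1)) Hq) :=
  {g | gᴴ * Jq n * g = Jq n}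

/-- The complex matrix `J_{m,1}`. -/
def Jc (m : ℕ) : Matrix (Fin (m+1)) (Fin (m+1)) ℂ :=
  Matrix.diagonal fun i => if i = Fin.last m then -1 else 1

/-- `SU(m,1)` as a set of `(m+1)×(m+1)` complex matrices. -/
def SU (m : ℕ) : Set (Matrix (Fin (m+1)) (Fin (m+1)) ℂ) :=
  {A | Aᴴ * Jc m * A = Jc m ∧ A.det = 1}

/-- The ℝ-algebra embedding `ℂ → ℍ`, `a + b√(−1) ↦ a + b i`. -/
def ι (z : ℂ) : Hq := ⟨z.re, z.im, 0, 0⟩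


@[simp] lemma ι_re (z : ℂ) : (ι z).re = z.re := rfl
@[simp] lemma ι_imI (z : ℂ) : (ι z).imI = z.im := rfl
@[simp] lemma ι_imJ (z : ℂ) : (ι z).imJ = 0 := rfl
@[simp] lemma ι_imK (z : ℂ) : (ι z).imK = 0 := rfl

lemma ι_I : ι Complex.I = qi := by
  ext <;> simp [qi]

lemma ι_zero : ι 0 = 0 := by
  ext <;> rfl

lemma ι_one : ι 1 = 1 := by
  ext <;> rfl

lemma ι_mul (z w : ℂ) : ι (z * w) = ι z * ι w := by
  ext <;> simp

lemma ι_star (z : ℂ) : ι (star z) = star (ι z) := by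
  ext <;> simp

lemma ι_star_I : ι (star Complex.I) = -qi := by
  rw [← ι_I]
  ext <;> simp

lemma ι_ofReal (r : ℝ) : ι (r : ℂ) = (r : Hq) := by
  ext <;> simp

lemma normSq_ι (z : ℂ) : Quaternion.normSq (ι z) = Complex.normSq z := by
  simp [Quaternion.normSq_def', Complex.normSq_apply]; ring

lemma exists_ι_eq_of_commute_qi {q : Hq} (h : qi * q = q * qi) : ∃ z : ℂ, q = ι z := by
  have h2 := congrArg QuaternionAlgebra.imJ h
  have h3 := congrArg QuaternionAlgebra.imK h
  rw [← ι_I] at h2 h3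
  simp at h2 h3
  exact ⟨⟨q.re, q.imI⟩, by ext <;> simp <;> linarith⟩

lemma re_mul_comm (p q : Hq) : (p * q).re = (q * p).re := by
  simp; ring

lemma eq_of_isRealQ_of_re_eq {x y : Hq} (hre : x.re = y.re)
    (h : isRealQ (star x - x + y - star y)) : x = y := by
  obtain ⟨h1, h2, h3⟩ := h
  simp at h1 h2 h3
  ext
  · exact hre
  all_goals linarith

lemma eq_zero_of_isRealQ {q : Hq} (hre : q.re = 0) (h : isRealQ q) : q = 0 :=
  QuaternionAlgebra.ext hre h.1 h.2.1 h.2.2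

lemma isRealQ_coe_add {r : ℝ} {q : Hq} : isRealQ ((r : Hq) + q) ↔ isRealQ q := by
  simp [isRealQ]

lemma isRealQ_conj {h : Hq} (r : ℝ) : isRealQ (h * (r : Hq) * star h) := by
  rw [(Quaternion.coe_commutes r h).symm, mul_assoc, Quaternion.self_mul_star,
    ← Quaternion.coe_mul]
  simp [isRealQ]

/-- The `J`-adjoint, which is the inverse on `Sp(1,1)`. -/
def jAdjoint (g : Matrix (Fin 2) (Fin 2) Hq) : Matrix (Fin 2) (Fin 2) Hq :=
  !![star (g 0 0), -star (g 1 0); -star (g 0 1), star (g 1 1)]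

lemma jAdjoint_mul_self {g : Matrix (Fin 2) (Fin 2) Hq} (hg : g ∈ Sp 1) :
    jAdjoint g * g = 1 := by
  have e : ∀ i j, (gᴴ * Jq 1 * g) i j = Jq 1 i j := fun i j => by rw [show _ = _ from hg]
  have h00 := e 0 0
  have h01 := e 0 1
  have h10 := e 1 0
  have h11 := e 1 1
  simp [Jq, Matrix.mul_apply, Fin.sum_univ_two, Matrix.diagonal_apply,
    show Fin.last 1 = 1 from rfl] at h00 h01 h10 h11
  ext1 i j
  fin_cases i <;> fin_cases j <;>
    simp only [jAdjoint, Matrix.mul_apply, Fin.sum_univ_two] <;> simp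
  · simpa using h00
  · simpa using h01
  · rw [← neg_eq_zero, ← h10]; abel
  · rw [← neg_inj, ← h11]; abel

lemma inverse_eq_jAdjoint {g : Matrix (Fin 2) (Fin 2) Hq} (hg : g ∈ Sp 1) :
    Ring.inverse g = jAdjoint g := by
  have h := jAdjoint_mul_self hg
  have h' : g * jAdjoint g = 1 := mul_eq_one_symm h
  exact Ring.inverse_unit (⟨g, jAdjoint g, h', h⟩ : (Matrix (Fin 2) (Fin 2) Hq)ˣ)

lemma mem_SU_one {α β : ℂ} (h : α * star α - β * star β = 1) :
    !![α, β; star β, star α] ∈ SU 1 := by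
  refine ⟨?_, ?_⟩
  · ext1 i j
    fin_cases i <;> fin_cases j <;>
      simp [Jc, Matrix.mul_apply, Fin.sum_univ_two, Matrix.diagonal_apply,
        show Fin.last 1 = 1 from rfl] <;> simp at h <;> first | ring1 | linear_combination h | linear_combination -h
  · simp [Matrix.det_fin_two]
    simp at h
    linear_combination h

lemma eq_of_mem_SU_one {A : Matrix (Fin 2) (Fin 2) ℂ} (hA : A ∈ SU 1) :
    A 1 0 = star (A 0 1) ∧ A 1 1 = star (A 0 0) := by
  obtain ⟨h, hd⟩ := hA
  have e : ∀ i j, (Aᴴ * Jc 1 * A) i j = Jc 1 i j := fun i j => by rw [h]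
  have h00 := e 0 0
  have h10 := e 1 0
  have h01 := e 0 1
  have h11 := e 1 1
  simp [Jc, Matrix.mul_apply, Fin.sum_univ_two, Matrix.diagonal_apply,
    show Fin.last 1 = 1 from rfl] at h00 h01 h10 h11
  rw [Matrix.det_fin_two] at hd
  simp
  constructor
  · linear_combination (-A 1 1) * h10 + A 1 0 * h11 + (starRingEnd ℂ) (A 0 1) * hd
  · linear_combination (-A 1 1) * h00 + A 1 0 * h01 + (starRingEnd ℂ) (A 0 0) * hd

lemma trace_conj {g A : Matrix (Fin 2) (Fin 2) Hq} :
    (g * A * jAdjoint g).trace =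
      g 0 0 * A 0 0 * star (g 0 0) + g 0 1 * A 1 0 * star (g 0 0)
      - g 0 0 * A 0 1 * star (g 0 1) - g 0 1 * A 1 1 * star (g 0 1)
      - g 1 0 * A 0 0 * star (g 1 0) - g 1 1 * A 1 0 * star (g 1 0)
      + g 1 0 * A 0 1 * star (g 1 1) + g 1 1 * A 1 1 * star (g 1 1) := by
  simp [Matrix.trace, jAdjoint, Matrix.mul_apply, Fin.sum_univ_two]
  noncomm_ring

lemma trace_conj_SU_one {g : Matrix (Fin 2) (Fin 2) Hq} {a b c d : Hq} (ha : g 0 0 = a)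
    (hb : g 0 1 = b) (hc : g 1 0 = c) (hd : g 1 1 = d) (α β : ℂ) :
    (g * (!![α, β; star β, star α]).map ι * jAdjoint g).trace =
      a * ι α * star a + b * ι (star β) * star a - a * ι β * star b
      - b * ι (star α) * star b - c * ι α * star c - d * ι (star β) * star c
      + c * ι β * star d + d * ι (star α) * star d := by
  rw [trace_conj, ← ha, ← hb, ← hc, ← hd]
  rfl

/-- Normalised form: if the first entry of `g` is scaled to `1`, all entries become complex. -/
lemma complex_of_relations {b c d : Hq} (hd : d * star d = 1)
    (hbc : b = star c * d) (h1 : star b = c * star d) (hi : qi * star b = c * qi * star d)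
    (hc : c * star c ≠ 1)
    (hE : qi - c * qi * star c + b * qi * star b - d * qi * star d = 0) :
    ∃ γ δ : ℂ, c = ι γ ∧ d = ι δ := by
  have hd' : star d * d = 1 := mul_eq_one_symm hd
  have hcomm : c * star d = star d * c := by
    rw [← h1, hbc]; simp
  have hcd : c * d = d * c := by
    calc c * d = d * star d * c * d := by rw [hd]; simp
      _ = d * (star d * c) * d := by noncomm_ring
      _ = d * c * (star d * d) := by rw [← hcomm]; noncomm_ring
      _ = d * c := by rw [hd']; simp
  have hci : qi * c = c * qi := by
    have : qi * c * star d = c * qi * star d := by rw [← hi, h1, mul_assoc]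
    calc qi * c = qi * c * star d * d := by rw [mul_assoc, hd']; simp
      _ = c * qi := by rw [this, mul_assoc, hd']; simp
  have hsc : star c * c = c * star c := by
    rw [Quaternion.star_mul_self, Quaternion.self_mul_star]
  have hb : b * qi * star b = star c * c * (d * qi * star d) := by
    rw [h1, hbc]
    calc star c * d * qi * (c * star d) = star c * d * (qi * c) * star d := by noncomm_ring
      _ = star c * (d * c) * qi * star d := by rw [hci]; noncomm_ring
      _ = _ := by rw [← hcd]; noncomm_ring
  have hcc : c * qi * star c = c * star c * qi := by
    rw [← hci, mul_assoc, Quaternion.self_mul_star, Quaternion.coe_commutes]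
  have hz : (1 - c * star c) * (qi - d * qi * star d) = 0 := by
    rw [← hE, hb, hcc, hsc]; noncomm_ring
  have hv : qi = d * qi * star d := by
    rcases mul_eq_zero.1 hz with h | h
    · exact absurd (sub_eq_zero.1 h).symm hc
    · exact sub_eq_zero.1 h
  have hdi : qi * d = d * qi := by
    calc qi * d = d * qi * star d * d := by rw [← hv]
      _ = d * qi := by rw [mul_assoc, hd']; simp
  obtain ⟨γ, hγ⟩ := exists_ι_eq_of_commute_qi hci
  obtain ⟨δ, hδ⟩ := exists_ι_eq_of_commute_qi hdi
  exact ⟨γ, δ, hγ, hδ⟩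

lemma isRealQ_trace_of_eq_smul {g : Matrix (Fin 2) (Fin 2) Hq} (hg : g ∈ Sp 1) {h : Hq}
    {A₀ : Matrix (Fin 2) (Fin 2) ℂ} (hA₀ : A₀ ∈ SU 1) (hgA : g = h • A₀.map ι)
    {A : Matrix (Fin 2) (Fin 2) ℂ} (hA : A ∈ SU 1) :
    isRealQ ((g * A.map ι * Ring.inverse g).trace) := by
  obtain ⟨h10, h11⟩ := eq_of_mem_SU_one hA₀
  obtain ⟨k10, k11⟩ := eq_of_mem_SU_one hA
  rw [inverse_eq_jAdjoint hg, trace_conj]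
  set t : ℝ := (2 * (A 0 0).re) * (Complex.normSq (A₀ 0 0) - Complex.normSq (A₀ 0 1)) with ht
  have key : (t : Hq) =
      ι (A₀ 0 0) * ι (A 0 0) * star (ι (A₀ 0 0)) + ι (A₀ 0 1) * ι (A 1 0) * star (ι (A₀ 0 0))
      - ι (A₀ 0 0) * ι (A 0 1) * star (ι (A₀ 0 1)) - ι (A₀ 0 1) * ι (A 1 1) * star (ι (A₀ 0 1))
      - ι (A₀ 1 0) * ι (A 0 0) * star (ι (A₀ 1 0)) - ι (A₀ 1 1) * ι (A 1 0) * star (ι (A₀ 1 0))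
      + ι (A₀ 1 0) * ι (A 0 1) * star (ι (A₀ 1 1))
      + ι (A₀ 1 1) * ι (A 1 1) * star (ι (A₀ 1 1)) := by
    rw [h10, h11, k10, k11, ht]
    ext <;> simp [Complex.normSq_apply] <;> ring
  convert isRealQ_conj (h := h) t using 1
  rw [key, hgA]
  simp only [Matrix.smul_apply, Matrix.map_apply, smul_eq_mul, star_mul]
  noncomm_ring

lemma off_diagonal_eq {a b c d : Hq} {r : ℝ} {β : ℂ} (hba : star b * a = star d * c)
    (h : isRealQ (a * ι r * star a + b * ι (star β) * star a - a * ι β * star b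
      - b * ι (star (r : ℂ)) * star b - c * ι r * star c - d * ι (star β) * star c
      + c * ι β * star d + d * ι (star (r : ℂ)) * star d)) :
    a * ι β * star b = c * ι β * star d := by
  apply eq_of_isRealQ_of_re_eq
  · rw [mul_assoc, re_mul_comm, mul_assoc, hba, ← mul_assoc, ← re_mul_comm, ← mul_assoc]
  · rw [← isRealQ_coe_add (r := r * (Quaternion.normSq a - Quaternion.normSq b
      - Quaternion.normSq c + Quaternion.normSq d))]
    convert h using 1
    have hr : ι (star (r : ℂ)) = (r : Hq) := by
      rw [← ι_ofReal]; simp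
    have hq (q : Hq) : q * (r : Hq) * star q = (r : Hq) * (Quaternion.normSq q : ℝ) := by
      rw [← Quaternion.coe_commutes r q, mul_assoc, Quaternion.self_mul_star]
    simp only [hr, ι_ofReal, hq, ι_star, star_mul, star_star, Quaternion.coe_mul,
      Quaternion.coe_add, Quaternion.coe_sub]
    noncomm_ring

lemma exists_unit_sq_eq {δ : ℂ} (hδ : δ * star δ = 1) :
    ∃ w : ℂ, w * w = δ ∧ w * star w = 1 := by
  obtain ⟨w, hw⟩ := IsAlgClosed.exists_eq_mul_self δ
  refine ⟨w, hw.symm, ?_⟩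
  rw [hw] at hδ
  simp only [Complex.star_def, map_mul, Complex.mul_conj] at hδ ⊢
  have : w * w * (star w * star w) = (Complex.normSq w : ℂ) * Complex.normSq w := by
    rw [← Complex.mul_conj]; simp; ring
  simp only [Complex.star_def] at this
  rw [this] at hδ
  norm_cast at hδ ⊢
  nlinarith [Complex.normSq_nonneg w]

lemma exists_eq_smul_of_isRealQ_trace {g : Matrix (Fin 2) (Fin 2) Hq} (hg : g ∈ Sp 1)
    (H : ∀ A ∈ SU 1, isRealQ ((g * A.map ι * Ring.inverse g).trace)) :
    ∃ h : Hq, ‖h‖ = 1 ∧ ∃ A₀ ∈ SU 1, g = h • A₀.map ι := by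
  have hl := jAdjoint_mul_self hg
  have hr : g * jAdjoint g = 1 := mul_eq_one_symm hl
  have l00 := congrFun₂ hl 0 0
  have l01 := congrFun₂ hl 0 1
  have r11 := congrFun₂ hr 1 1
  rw [inverse_eq_jAdjoint hg] at H
  have sq2 : (√2 : ℂ) * (√2 : ℂ) = 2 := by
    rw [← Complex.ofReal_mul, Real.mul_self_sqrt (by norm_num)]; norm_num
  simp only [jAdjoint, Matrix.mul_apply, Fin.sum_univ_two] at l00 l01 r11
  simp at l00 l01 r11
  obtain ⟨a, ha⟩ : ∃ a, g 0 0 = a := ⟨_, rfl⟩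
  obtain ⟨b, hb⟩ : ∃ b, g 0 1 = b := ⟨_, rfl⟩
  obtain ⟨c, hc⟩ : ∃ c, g 1 0 = c := ⟨_, rfl⟩
  obtain ⟨d, hd⟩ : ∃ d, g 1 1 = d := ⟨_, rfl⟩
  have T (α β : ℂ) (h : α * star α - β * star β = 1) := H _ (mem_SU_one h)
  simp only [trace_conj_SU_one ha hb hc hd] at T
  rw [ha, hc] at l00
  rw [ha, hb, hc, hd] at l01
  rw [hc, hd] at r11
  have hab : star a * b = star c * d := by
    rw [← sub_eq_zero, ← l01]; abel
  have hba : star b * a = star d * c := by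
    simpa using congrArg star hab
  have E1 := T Complex.I 0 (by simp)
  have E2 := off_diagonal_eq hba (T (√2 : ℝ) 1 (by simp [sq2]; norm_num))
  have E3 := off_diagonal_eq hba (T (√2 : ℝ) Complex.I (by simp [sq2]; norm_num))
  replace l00 : Quaternion.normSq a - Quaternion.normSq c = 1 := by
    apply Quaternion.coe_injective
    rw [Quaternion.coe_sub, Quaternion.coe_one, ← Quaternion.star_mul_self,
      ← Quaternion.star_mul_self, sub_eq_add_neg]
    exact l00
  replace r11 : -Quaternion.normSq c + Quaternion.normSq d = 1 := by
    apply Quaternion.coe_injective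
    rw [Quaternion.coe_add, Quaternion.coe_neg, Quaternion.coe_one, ← Quaternion.self_mul_star,
      ← Quaternion.self_mul_star]
    exact r11
  have ha0 : a ≠ 0 := by
    rintro rfl
    have := Quaternion.normSq_nonneg (a := c)
    simp at l00
    linarith
  obtain ⟨b, rfl⟩ : ∃ b', b = a * b' := ⟨a⁻¹ * b, (mul_inv_cancel_left₀ ha0 b).symm⟩
  obtain ⟨c, rfl⟩ : ∃ c', c = a * c' := ⟨a⁻¹ * c, (mul_inv_cancel_left₀ ha0 c).symm⟩
  obtain ⟨d, rfl⟩ : ∃ d', d = a * d' := ⟨a⁻¹ * d, (mul_inv_cancel_left₀ ha0 d).symm⟩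
  rw [map_mul] at l00 r11
  rw [map_mul] at r11
  have hN : Quaternion.normSq a ≠ 0 := Quaternion.normSq_ne_zero.2 ha0
  have hsa : star a ≠ 0 := star_ne_zero.2 ha0
  have cancel {x y : Hq} (h : a * x * star a = a * y * star a) : x = y :=
    mul_left_cancel₀ ha0 (mul_right_cancel₀ hsa h)
  have hdd : d * star d = 1 := by
    rw [Quaternion.self_mul_star]
    have : Quaternion.normSq d = 1 := mul_left_cancel₀ hN (by linarith)
    rw [this, Quaternion.coe_one]
  have hbc : b = star c * d := by
    have : ((Quaternion.normSq a : ℝ) : Hq) * b = (Quaternion.normSq a : ℝ) * (star c * d) := by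
      rw [← mul_assoc, Quaternion.coe_commutes _ (star c), mul_assoc (star c),
        ← Quaternion.star_mul_self, mul_assoc, hab]
      simp only [star_mul, mul_assoc]
    exact mul_left_cancel₀ (fun h => hN (Quaternion.coe_injective h)) this
  have h1 : star b = c * star d := by
    apply cancel
    simpa [ι_one, mul_assoc] using E2
  have hi : qi * star b = c * qi * star d := by
    apply cancel
    simpa [ι_I, mul_assoc] using E3
  have hc1 : c * star c ≠ 1 := by
    rw [Quaternion.self_mul_star]
    intro h
    have : Quaternion.normSq c = 1 := Quaternion.coe_injective h
    rw [this] at l00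
    simp at l00
  have hE : qi - c * qi * star c + b * qi * star b - d * qi * star d = 0 := by
    have re_conj (q : Hq) : (q * qi * star q).re = 0 := by
      rw [← ι_I]; simp; ring
    simp only [ι_I, star_zero, ι_zero, ι_star_I] at E1
    apply cancel
    rw [mul_zero, zero_mul]
    trans a * qi * star a - a * c * qi * star (a * c) + a * b * qi * star (a * b)
      - a * d * qi * star (a * d)
    · simp only [star_mul]; noncomm_ring
    apply eq_zero_of_isRealQ
    · simp only [Quaternion.re_sub, Quaternion.re_add, re_conj]; simp
    · convert E1 using 1
      noncomm_ring
  obtain ⟨γ, δ, rfl, rfl⟩ := complex_of_relations hdd hbc h1 hi hc1 hE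
  have hδ : δ * star δ = 1 := by
    rw [Quaternion.self_mul_star, normSq_ι] at hdd
    rw [Complex.star_def, Complex.mul_conj]
    exact congrArg _ (Quaternion.coe_injective hdd)
  obtain ⟨w, hw, hw1⟩ := exists_unit_sq_eq hδ
  have hr0 : (‖a‖ : ℂ) ≠ 0 := by exact_mod_cast norm_ne_zero_iff.2 ha0
  have hw2 : ‖w‖ = 1 := by
    rw [Complex.star_def, Complex.mul_conj, Complex.normSq_eq_norm_sq] at hw1
    norm_cast at hw1
    nlinarith [norm_nonneg w]
  have hnorm : (‖a‖ : ℂ) * ‖a‖ * (1 - γ * star γ) = 1 := by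
    rw [Complex.star_def, Complex.mul_conj]
    rw [normSq_ι, Quaternion.normSq_eq_norm_mul_self] at l00
    norm_cast
    linarith
  refine ⟨a * ι ((‖a‖ : ℂ)⁻¹ * w), ?_, _,
    mem_SU_one (α := ‖a‖ * star w) (β := ‖a‖ * (star γ * w)) ?_, ?_⟩
  · have : ‖ι ((‖a‖ : ℂ)⁻¹ * w)‖ = ‖(‖a‖ : ℂ)⁻¹ * w‖ := by
      rw [← sq_eq_sq₀ (norm_nonneg _) (norm_nonneg _), ← Complex.normSq_eq_norm_sq, ← normSq_ι,
        Quaternion.normSq_eq_norm_mul_self, sq]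
    rw [norm_mul, this, norm_mul, hw2]
    simp [ha0]
  · simp only [Complex.star_def, map_mul, Complex.conj_ofReal, Complex.conj_conj] at hnorm hw1 ⊢
    linear_combination hnorm + ‖a‖ * ‖a‖ * (1 - γ * (starRingEnd ℂ) γ) * hw1
  · have entry {x : Hq} {z : ℂ} (u : ℂ) (hx : x = a * ι u) (hz : z = ‖a‖ * (star w * u)) :
        x = a * ι ((‖a‖ : ℂ)⁻¹ * w) * ι z := by
      rw [hx, mul_assoc, ← ι_mul, hz]
      congr 2
      field_simp
      linear_combination (-u) * hw1
    ext1 i j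
    fin_cases i <;> fin_cases j
    · exact ha.trans (entry 1 (by rw [ι_one, mul_one]) (by simp))
    · refine hb.trans (entry (star γ * δ) (by rw [hbc, ι_mul, ι_star]) ?_)
      change (‖a‖ : ℂ) * (star γ * w) = _
      rw [← hw]
      linear_combination (-‖a‖ * star γ * w) * hw1
    · refine hc.trans (entry γ rfl ?_)
      simp only [of_apply]
      change star ((‖a‖ : ℂ) * (star γ * w)) = _
      simp only [Complex.star_def, map_mul, Complex.conj_ofReal, Complex.conj_conj]
      ring
    · refine hd.trans (entry δ rfl ?_)
      change star ((‖a‖ : ℂ) * star w) = _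
      rw [← hw]
      simp only [Complex.star_def, map_mul, Complex.conj_ofReal, Complex.conj_conj] at hw1 ⊢
      linear_combination (-‖a‖ * w) * hw1

/-- For `g ∈ Sp(1,1)`, the trace of `g·ι(A)·g⁻¹` is real for every
`A ∈ SU(1,1)` iff `g = h · ι(A₀)` for some unit quaternion `h` and `A₀ ∈ SU(1,1)`. -/
theorem stmt0 (g : Matrix (Fin 2) (Fin 2) Hq) (hg : g ∈ Sp 1) :
    (∀ A ∈ SU 1, isRealQ ((g * A.map ι * Ring.inverse g).trace)) ↔
      ∃ h : Hq, ‖h‖ = 1 ∧ ∃ A₀ ∈ SU 1, g = h • A₀.map ι :=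
  ⟨exists_eq_smul_of_isRealQ_trace hg,
    fun ⟨_, _, _, hA₀, hgA⟩ _ hA => isRealQ_trace_of_eq_smul hg hA₀ hgA hA⟩
end
end

section
/- For every g ∈ Sp(2,1), the set { trace(g·(1⊕A)·g⁻¹) : A ∈ Sp(1,1) } is not contained in ℝ, where 1⊕A denotes the 3×3 block diagonal matrix with upper-left entry 1 and lower-right 2×2 block A. That is, there exists A ∈ Sp(1,1) such that trace(g·(1⊕A)·g⁻¹) is not real. -/
open Matrix BigOperators

noncomputable section

/-- Block diagonal sum of square matrices. -/
def oplus {R : Type*} [Zero R] {p q : ℕ} (A : Matrix (Fin p) (Fin p) R)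
    (B : Matrix (Fin q) (Fin q) R) : Matrix (Fin (p + q)) (Fin (p + q)) R :=
  Matrix.reindex finSumFinEquiv finSumFinEquiv (Matrix.fromBlocks A 0 0 B)

open Quaternion in
theorem exists_unit_imaginary_commute (h : Quaternion ℝ) :
    ∃ p : Quaternion ℝ, p.re = 0 ∧ normSq p = 1 ∧ h * p = p * h := by
  by_cases hz : h.im = 0
  · refine ⟨qi, rfl, by rw [normSq_def']; simp [qi], ?_⟩
    have hh : h = (h.re : Quaternion ℝ) := by
      rw [← Quaternion.re_add_im h, hz]
      simp
    rw [hh]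
    exact coe_commutes _ _
  · have hn : ‖h.im‖ ≠ 0 := norm_ne_zero_iff.mpr hz
    refine ⟨‖h.im‖⁻¹ • h.im, by simp, ?_, ?_⟩
    · rw [normSq_smul, normSq_eq_norm_mul_self]
      field_simp
    · rw [mul_smul_comm, smul_mul_assoc]
      congr 1
      rw [show h.im = h - (h.re : Quaternion ℝ) from eq_sub_of_add_eq' h.re_add_im, mul_sub,
        sub_mul, coe_commutes]

open Quaternion in
theorem exists_unit_imaginary_conj_sum_ne_zero (x y z : Quaternion ℝ)
    (hxyz : normSq x + normSq y - normSq z = 1) :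
    ∃ p : Quaternion ℝ, p.re = 0 ∧ normSq p = 1 ∧
      x * p * star x + y * p * star y - z * p * star z ≠ 0 := by
  obtain ⟨p, hp0, hp1, hp⟩ := exists_unit_imaginary_commute (star x * y)
  refine ⟨p, hp0, hp1, fun h => ?_⟩
  have hpar : normSq x • (y * p * star y) = normSq y • (x * p * star x) := by
    rw [← coe_mul_eq_smul, ← mul_coe_eq_smul, ← self_mul_star, ← self_mul_star]
    calc x * star x * (y * p * star y) = x * (star x * y * p) * star y := by noncomm_ring
      _ = x * p * star x * (y * star y) := by rw [hp]; noncomm_ring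
  have hs : normSq (x * p * star x + y * p * star y) = normSq z ^ 2 := by
    rw [sub_eq_zero.mp h]
    simp [hp1, sq]
  have hx : 0 ≤ normSq x := normSq_nonneg
  have hy : 0 ≤ normSq y := normSq_nonneg
  have hz : 0 ≤ normSq z := normSq_nonneg
  have key : (normSq x + normSq y) ^ 2 = normSq z ^ 2 := by
    by_cases hx0 : x = 0
    · rw [← hs]
      simp [hx0, hp1, sq]
    · have hxne : normSq x ≠ 0 := normSq_ne_zero.mpr hx0
      have e : normSq x • (x * p * star x + y * p * star y)
          = (normSq x + normSq y) • (x * p * star x) := by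
        rw [smul_add, hpar, add_smul]
      have e2 := congrArg normSq e
      rw [normSq_smul, normSq_smul, hs] at e2
      simp only [map_mul, normSq_star, hp1, mul_one] at e2
      have : normSq x ^ 2 ≠ 0 := pow_ne_zero 2 hxne
      apply mul_left_cancel₀ this
      linarith
  nlinarith

theorem Sp_inverse {n : ℕ} {g : Matrix (Fin (n + 1)) (Fin (n + 1)) Hq} (hg : g ∈ Sp n) :
    Ring.inverse g = Jq n * gᴴ * Jq n := by
  have hJ : Jq n * Jq n = 1 := by
    rw [Jq, Matrix.diagonal_mul_diagonal, ← Matrix.diagonal_one]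
    congr 1
    ext1 i
    split_ifs <;> simp
  have hl : Jq n * gᴴ * Jq n * g = 1 := by
    rw [mul_assoc (Jq n), mul_assoc (Jq n), show gᴴ * Jq n * g = Jq n from hg, hJ]
  exact Ring.inverse_unit (⟨g, Jq n * gᴴ * Jq n, mul_eq_one_comm.mp hl, hl⟩ : (Matrix _ _ Hq)ˣ)

theorem diagonal_mem_Sp_one {p : Hq} (hp : Quaternion.normSq p = 1) :
    Matrix.diagonal ![p, 1] ∈ Sp 1 := by
  have h : star p * p = 1 := by rw [Quaternion.star_mul_self, hp]; rfl
  change (Matrix.diagonal ![p, 1])ᴴ * Jq 1 * Matrix.diagonal ![p, 1] = Jq 1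
  rw [Jq, Matrix.diagonal_conjTranspose, Matrix.diagonal_mul_diagonal,
    Matrix.diagonal_mul_diagonal]
  congr 1
  ext1 i
  fin_cases i <;> simp [h, Fin.last]

theorem one_oplus_diagonal (p : Hq) :
    oplus (1 : Matrix (Fin 1) (Fin 1) Hq) (Matrix.diagonal ![p, 1])
      = (Matrix.diagonal ![1, p, 1] : Matrix (Fin 3) (Fin 3) Hq) := by
  ext1 i j
  fin_cases i <;> fin_cases j <;> rfl

/-- for every `g ∈ Sp(2,1)` the set of traces of `g·(1⊕Sp(1,1))·g⁻¹` is not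
contained in `ℝ`: some `A ∈ Sp(1,1)` gives a non-real trace. -/
theorem stmt6 (g : Matrix (Fin 3) (Fin 3) Hq) (hg : g ∈ Sp 2) :
    ∃ A ∈ Sp 1,
      ¬ isRealQ ((g * oplus (1 : Matrix (Fin 1) (Fin 1) Hq) A * Ring.inverse g).trace) := by
  have hcol := congrFun (congrFun (show gᴴ * Jq 2 * g = Jq 2 from hg) 1) 1
  have hxyz : Quaternion.normSq (g 0 1) + Quaternion.normSq (g 1 1)
      - Quaternion.normSq (g 2 1) = 1 := by
    have := congrArg (fun q : Hq => q.re) hcol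
    simp [Jq, Matrix.mul_apply, Fin.sum_univ_three, Matrix.diagonal_apply, Fin.last] at this
    simp only [Quaternion.normSq_def']
    change _ = (1 : ℝ) at this
    linarith
  obtain ⟨p, hp0, hp1, hne⟩ := exists_unit_imaginary_conj_sum_ne_zero _ _ _ hxyz
  refine ⟨Matrix.diagonal ![p, 1], diagonal_mem_Sp_one hp1, fun hreal => hne ?_⟩
  have htr : (g * oplus (1 : Matrix (Fin 1) (Fin 1) Hq) (Matrix.diagonal ![p, 1])
      * Ring.inverse g).trace
      = (g 0 1 * p * star (g 0 1) + g 1 1 * p * star (g 1 1) - g 2 1 * p * star (g 2 1))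
        + (g 0 0 * star (g 0 0) + g 1 0 * star (g 1 0) - g 2 0 * star (g 2 0)
          - (g 0 2 * star (g 0 2) + g 1 2 * star (g 1 2) - g 2 2 * star (g 2 2))) := by
    rw [one_oplus_diagonal, Sp_inverse hg]
    simp [Jq, Matrix.trace, Matrix.mul_apply, Fin.sum_univ_three, Matrix.diagonal_apply, Fin.last]
    abel
  rw [htr] at hreal
  simp only [Quaternion.self_mul_star] at hreal
  obtain ⟨hI, hJ, hK⟩ := hreal
  ext
  · change _ = (0 : ℝ)
    simp [hp0]
    ring
  · change _ = (0 : ℝ)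
    simpa using hI
  · change _ = (0 : ℝ)
    simpa using hJ
  · change _ = (0 : ℝ)
    simpa using hK
end
end

section
/- Let n ≥ 1 and let d_n ∈ Sp(n,1) be the diagonal (n+1)×(n+1) matrix with diagonal entries (1,…,1,i), where i is the quaternion unit. If G is a subset of Sp(n,1) with d_n ∈ G, then for every g ∈ Sp(n,1) the set { trace(g·a·g⁻¹) : a ∈ G } is not contained in ℝ; in particular, trace(g·d_n·g⁻¹) is not real for every g ∈ Sp(n,1). -/
open Matrix BigOperators

noncomputable section

/-- The diagonal matrix `d_n = diag(1,…,1,i)`. -/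
def dmat (n : ℕ) : Matrix (Fin (n+1)) (Fin (n+1)) Hq :=
  Matrix.diagonal fun idx => if idx = Fin.last n then qi else 1

theorem re_sum_Hq {n : ℕ} (f : Fin n → Hq) : (∑ k, f k).re = ∑ k, (f k).re :=
  map_sum (AddMonoidHom.mk' (fun q : Hq => q.re) fun _ _ => rfl) f Finset.univ

theorem Jq_mul_Jq (n : ℕ) : Jq n * Jq n = 1 := by
  rw [Jq, diagonal_mul_diagonal, ← diagonal_one]
  congr 1
  funext k
  split_ifs <;> simp

theorem norm_mul_qi_mul_star (x : Hq) : ‖x * qi * star x‖ = ‖x‖ ^ 2 := by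
  have h : ‖qi‖ = 1 := by
    have := Quaternion.normSq_eq_norm_mul_self qi
    rw [Quaternion.normSq_def'] at this
    have h2 : ‖qi‖ * ‖qi‖ = 1 := by rw [← this]; simp [qi]
    nlinarith [norm_nonneg qi]
  rw [norm_mul, norm_mul, h, norm_star]
  ring

theorem re_mul_qi_mul_star (x : Hq) : (x * qi * star x).re = 0 := by
  simp only [Quaternion.re_mul, Quaternion.imI_mul, Quaternion.imJ_mul, Quaternion.imK_mul,
    Quaternion.re_star, Quaternion.imI_star, Quaternion.imJ_star, Quaternion.imK_star]
  simp only [qi]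
  ring

theorem dmat_eq (n : ℕ) :
    dmat n = 1 + single (Fin.last n) (Fin.last n) (qi - 1) := by
  rw [dmat, ← diagonal_one, ← diagonal_single, diagonal_add]
  congr 1
  funext k
  by_cases h : k = Fin.last n <;> simp [h]

theorem dmat_mem_Sp (n : ℕ) : dmat n ∈ Sp n := by
  change (dmat n)ᴴ * Jq n * dmat n = Jq n
  rw [dmat, Jq, diagonal_conjTranspose, diagonal_mul_diagonal, diagonal_mul_diagonal]
  congr 1
  funext k
  by_cases h : k = Fin.last n
  · have hq : star qi * qi = (1 : Hq) := by
      rw [Quaternion.star_mul_self, Quaternion.normSq_def']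
      simp [qi]
    simp [h, hq]
  · simp [h]

/-- Elements of `Sp(n,1)` have inverse `J gᴴ J`. -/
theorem inverse_mul_of_mem_Sp {n : ℕ} {g : Matrix (Fin (n+1)) (Fin (n+1)) Hq} (hg : g ∈ Sp n) :
    Jq n * gᴴ * Jq n * g = 1 := by
  have h : gᴴ * Jq n * g = Jq n := hg
  rw [Matrix.mul_assoc, Matrix.mul_assoc, ← Matrix.mul_assoc gᴴ, h, Jq_mul_Jq]

theorem ringInverse_of_mem_Sp {n : ℕ} {g : Matrix (Fin (n+1)) (Fin (n+1)) Hq} (hg : g ∈ Sp n) :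
    Ring.inverse g = Jq n * gᴴ * Jq n := by
  have h := inverse_mul_of_mem_Sp hg
  exact Ring.inverse_unit ⟨g, Jq n * gᴴ * Jq n, mul_eq_one_comm.mp h, h⟩

/-- The last column of an element of `Sp(n,1)` is a negative unit vector. -/
theorem sum_norm_sq_last_col {n : ℕ} {g : Matrix (Fin (n+1)) (Fin (n+1)) Hq} (hg : g ∈ Sp n) :
    ∑ k : Fin n, ‖g k.castSucc (Fin.last n)‖ ^ 2 = ‖g (Fin.last n) (Fin.last n)‖ ^ 2 - 1 := by
  have h : (gᴴ * Jq n * g) (Fin.last n) (Fin.last n) = Jq n (Fin.last n) (Fin.last n) :=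
    congrFun (congrFun hg _) _
  rw [Matrix.mul_apply, Fin.sum_univ_castSucc] at h
  simp only [Jq, mul_diagonal, conjTranspose_apply, diagonal_apply_eq, Fin.castSucc_ne_last,
    if_true, if_false, mul_one, mul_neg, neg_mul, Quaternion.star_mul_self,
    Quaternion.normSq_eq_norm_mul_self] at h
  have h' := congrArg (QuaternionAlgebra.re) h
  simp only [Quaternion.re_add, Quaternion.re_neg, re_sum_Hq, Quaternion.re_coe, Quaternion.re_one,
    ← pow_two] at h'
  linarith

/-- The trace of `g d_n g⁻¹` in terms of the last column of `g`. -/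
theorem trace_conj_dmat {n : ℕ} {g : Matrix (Fin (n+1)) (Fin (n+1)) Hq} (hg : g ∈ Sp n) :
    (g * dmat n * Ring.inverse g).trace = ((n : ℝ) : Hq) +
      (g (Fin.last n) (Fin.last n) * qi * star (g (Fin.last n) (Fin.last n)) -
        ∑ k : Fin n, g k.castSucc (Fin.last n) * qi * star (g k.castSucc (Fin.last n))) := by
  have h1 : g * (Jq n * gᴴ * Jq n) = 1 := mul_eq_one_comm.mp (inverse_mul_of_mem_Sp hg)
  have hs := congrArg (fun r : ℝ => (r : Hq)) (sum_norm_sq_last_col hg)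
  have hc : ∀ x : Hq, ((‖x‖ ^ 2 : ℝ) : Hq) = x * star x := fun x => by
    rw [Quaternion.self_mul_star, Quaternion.normSq_eq_norm_mul_self, pow_two]
  have hsum : ∀ f : Fin n → ℝ, ((∑ k, f k : ℝ) : Hq) = ∑ k, (f k : Hq) := fun f =>
    map_sum (algebraMap ℝ Hq) f Finset.univ
  simp only [hsum, Quaternion.coe_sub, hc, Quaternion.coe_one] at hs
  rw [ringInverse_of_mem_Sp hg, dmat_eq, Matrix.mul_add, Matrix.mul_one, Matrix.add_mul, h1,
    trace_add, trace_one, Fintype.card_fin, trace, Fin.sum_univ_castSucc]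
  have he : ∀ k, (g * single (Fin.last n) (Fin.last n) (qi - 1) * (Jq n * gᴴ * Jq n)).diag k =
      g k (Fin.last n) * (qi - 1) * (Jq n * gᴴ * Jq n) (Fin.last n) k := fun k => by
    rw [diag_apply, Matrix.mul_apply, Finset.sum_eq_single (Fin.last n)]
    · simp
    · intro b _ hb
      simp [Matrix.mul_single_apply_of_ne, hb]
    · simp
  rw [he, Finset.sum_congr rfl fun k _ => he (Fin.castSucc k)]
  simp only [Jq, mul_diagonal, diagonal_mul, conjTranspose_apply, Fin.castSucc_ne_last,
    if_true, if_false, mul_one, mul_neg, neg_mul, one_mul, neg_neg, mul_sub, sub_mul,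
    Finset.sum_neg_distrib, Finset.sum_sub_distrib, hs]
  push_cast
  abel

theorem trace_conj_dmat_not_real {n : ℕ} {g : Matrix (Fin (n+1)) (Fin (n+1)) Hq}
    (hg : g ∈ Sp n) : ¬ isRealQ ((g * dmat n * Ring.inverse g).trace) := by
  rw [trace_conj_dmat hg]
  rintro ⟨hI, hJ, hK⟩
  have h0 : g (Fin.last n) (Fin.last n) * qi * star (g (Fin.last n) (Fin.last n)) -
      ∑ k : Fin n, g k.castSucc (Fin.last n) * qi * star (g k.castSucc (Fin.last n)) = 0 := by
    rw [Quaternion.imI_add, Quaternion.imI_coe, zero_add] at hI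
    rw [Quaternion.imJ_add, Quaternion.imJ_coe, zero_add] at hJ
    rw [Quaternion.imK_add, Quaternion.imK_coe, zero_add] at hK
    refine Quaternion.ext _ _ ?_ hI hJ hK
    simp only [Quaternion.re_sub, re_sum_Hq, re_mul_qi_mul_star, Finset.sum_const_zero, sub_zero,
      Quaternion.re_zero]
  have hle := norm_sum_le Finset.univ fun k : Fin n =>
    g k.castSucc (Fin.last n) * qi * star (g k.castSucc (Fin.last n))
  rw [← sub_eq_zero.mp h0] at hle
  simp only [norm_mul_qi_mul_star, sum_norm_sq_last_col hg] at hle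
  linarith

/-- `d_n ∈ Sp(n,1)`, and if `G ⊆ Sp(n,1)` contains `d_n` then for every
`g ∈ Sp(n,1)` the set of traces of `gGg⁻¹` is not contained in `ℝ`; in particular
`trace(g·d_n·g⁻¹)` is never real. -/
theorem stmt9 (n : ℕ) (hn : 1 ≤ n)
    (G : Set (Matrix (Fin (n+1)) (Fin (n+1)) Hq)) (hG : G ⊆ Sp n) (hd : dmat n ∈ G) :
    dmat n ∈ Sp n ∧
    (∀ g ∈ Sp n, ∃ a ∈ G, ¬ isRealQ ((g * a * Ring.inverse g).trace)) ∧
    (∀ g ∈ Sp n, ¬ isRealQ ((g * dmat n * Ring.inverse g).trace)) := by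
  exact ⟨dmat_mem_Sp n, fun g hg => ⟨dmat n, hd, trace_conj_dmat_not_real hg⟩,
    fun g hg => trace_conj_dmat_not_real hg⟩
end
end

section
/- Let r ≥ 1 and let a₁, …, a_r ∈ ℝ satisfy Σ_{j=1}^{r} a_j^{2s+1} = 0 for every integer s ≥ 0. Then the multiset {a₁, …, a_r} is invariant under negation, i.e., the multiset {−a₁, …, −a_r} equals the multiset {a₁, …, a_r}; equivalently, after reordering, (a₁,…,a_r) has the form (b₁, −b₁, …, b_k, −b_k, 0, …, 0). -/
open BigOperators

section PowerSums

variable {K : Type*} [CommRing K]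

open Polynomial

/-- Multisets with equal power sums have equal sums of values of every polynomial. -/
theorem Multiset.sum_map_eval_eq_of_sum_map_pow_eq {s t : Multiset K}
    (h : ∀ n : ℕ, (s.map (· ^ n)).sum = (t.map (· ^ n)).sum) (p : K[X]) :
    (s.map fun x => p.eval x).sum = (t.map fun x => p.eval x).sum := by
  induction p using Polynomial.induction_on' with
  | add p q hp hq => simp only [eval_add, Multiset.sum_map_add, hp, hq]
  | monomial n c => simp only [eval_monomial, Multiset.sum_map_mul_left, h n]

/-- If `p` vanishes on all elements of `s` other than `x`, the sum of its values over `s`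
is the multiplicity of `x` times `p x`. -/
theorem Multiset.sum_map_eval_eq_count_mul [DecidableEq K] (s : Multiset K) (p : K[X]) (x : K)
    (hp : ∀ y ∈ s, y ≠ x → p.eval y = 0) :
    (s.map fun y => p.eval y).sum = s.count x * p.eval x := by
  rw [Finset.sum_multiset_map_count, Finset.sum_eq_single x, nsmul_eq_mul]
  · intro y hy hyx
    rw [hp y (Multiset.mem_toFinset.1 hy) hyx, smul_zero]
  · intro hx
    rw [Multiset.count_eq_zero.2 (fun hs => hx (Multiset.mem_toFinset.2 hs)), zero_smul]

/-- Over a domain of characteristic zero a multiset is determined by its power sums. -/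
theorem Multiset.eq_of_sum_map_pow_eq [IsDomain K] [CharZero K] {s t : Multiset K}
    (h : ∀ n : ℕ, (s.map (· ^ n)).sum = (t.map (· ^ n)).sum) : s = t := by
  classical
  ext x
  set p : K[X] := ∏ y ∈ (s + t).toFinset.erase x, (X - C y) with hp
  have hroot : ∀ y ∈ s + t, y ≠ x → p.eval y = 0 := by
    intro y hy hyx
    rw [hp, eval_prod]
    exact Finset.prod_eq_zero (Finset.mem_erase.2 ⟨hyx, Multiset.mem_toFinset.2 hy⟩) (by simp)
  have hx : p.eval x ≠ 0 := by
    rw [hp, eval_prod, Finset.prod_ne_zero_iff]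
    intro y hy
    simpa [sub_eq_zero] using (Finset.ne_of_mem_erase hy).symm
  have key := Multiset.sum_map_eval_eq_of_sum_map_pow_eq h p
  rw [s.sum_map_eval_eq_count_mul p x fun y hy => hroot y (Multiset.mem_add.2 (Or.inl hy)),
    t.sum_map_eval_eq_count_mul p x fun y hy => hroot y (Multiset.mem_add.2 (Or.inr hy))] at key
  exact_mod_cast mul_right_cancel₀ hx key

end PowerSums

/-- if all odd power sums of the real numbers `a₁,…,a_r` vanish, then the
multiset `{a₁,…,a_r}` is invariant under negation. -/
theorem stmt14 (r : ℕ) (hr : 1 ≤ r) (a : Fin r → ℝ)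
    (h : ∀ s : ℕ, ∑ j, a j ^ (2 * s + 1) = 0) :
    Multiset.map (fun x => -x) (Multiset.map a Finset.univ.val)
      = Multiset.map a Finset.univ.val := by
  apply Multiset.eq_of_sum_map_pow_eq
  intro n
  simp only [Multiset.map_map, Function.comp_def]
  change ∑ j, (-a j) ^ n = ∑ j, a j ^ n
  rcases n.even_or_odd with hn | hn
  · simp only [hn.neg_pow]
  · obtain ⟨s, rfl⟩ := hn
    simp only [(odd_two_mul_add_one s).neg_pow, Finset.sum_neg_distrib, h s, neg_zero]
end

section
/- Let r ≥ 1 and let a₁, …, a_r ∈ ℝ. If sin(a₁ t) + sin(a₂ t) + ⋯ + sin(a_r t) = 0 for every t ∈ ℝ, then Σ_{j=1}^{r} a_j^{2s+1} = 0 for every integer s ≥ 0. -/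
open BigOperators

/-- if `sin(a₁ t) + ⋯ + sin(a_r t) = 0` for all real `t`, then all the odd
power sums of `a₁,…,a_r` vanish. -/
theorem stmt15 (r : ℕ) (hr : 1 ≤ r) (a : Fin r → ℝ)
    (h : ∀ t : ℝ, ∑ j, Real.sin (a j * t) = 0) :
    ∀ s : ℕ, ∑ j, a j ^ (2 * s + 1) = 0 := by
  intro s
  have hderiv : iteratedDeriv (2 * s + 1) (fun t : ℝ => ∑ j, Real.sin (a j * t)) 0 = 0 := by
    simp [h]
  rw [iteratedDeriv_fun_sum fun j _ => by fun_prop] at hderiv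
  have hterm (j : Fin r) : iteratedDeriv (2 * s + 1) (fun t : ℝ => Real.sin (a j * t)) 0 =
      (-1) ^ s * a j ^ (2 * s + 1) := by
    rw [iteratedDeriv_comp_const_mul Real.contDiff_sin, Real.iteratedDeriv_odd_sin]
    simp [mul_comm]
  simpa [hterm, ← Finset.mul_sum] using hderiv
end
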